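/- There is an absolute constant C > 0 with the following property. Let r > 0, ρ > 0 with 0 < |ρ−r| ≤ r/4, let z, l ∈ [0,1] with (ρ,l) ≠ (r,z), and set x = (r, 0, z) and y(φ) = (ρ cos φ, ρ sin φ, l). If 1 ≤ |ρ−r| ≤ r/4, then ∫₀^{2π} ( |∂_ρ G(x,y(φ))| + |∂_r G(x,y(φ))| ) dφ ≤ C / (r |ρ−r|²). If 0 < |ρ−r| < 1, then ∫₀^{2π} ( |∂_ρ G(x,y(φ))| + |∂_r G(x,y(φ))| ) dφ ≤ C / ( r (|ρ−r| + |z−l|) ). -/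

import Mathlib

open Real

/-- The general term of the series defining the Green function of the Laplacian on
`ℝ² × [0,1]` with Dirichlet boundary conditions; `d = |x' − y'|`. -/
noncomputable def greenTerm (d x3 y3 : ℝ) (n : ℤ) : ℝ :=
  1 / Real.sqrt (d ^ 2 + (x3 - y3 + 2 * (n : ℝ)) ^ 2)
    - 1 / Real.sqrt (d ^ 2 + (x3 + y3 - 2 * (n : ℝ)) ^ 2)

/-- The Green function of the Laplacian on `ℝ² × [0,1]` with Dirichlet boundary
conditions. -/
noncomputable def greenG (x' : EuclideanSpace ℝ (Fin 2)) (x3 : ℝ)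
    (y' : EuclideanSpace ℝ (Fin 2)) (y3 : ℝ) : ℝ :=
  (1 / (4 * π)) * ∑' n : ℤ, greenTerm (‖x' - y'‖) x3 y3 n

/-- The point of `ℝ²` (with the Euclidean norm) with coordinates `(a, b)`. -/
noncomputable def vec2 (a b : ℝ) : EuclideanSpace ℝ (Fin 2) :=
  (WithLp.equiv 2 (Fin 2 → ℝ)).symm ![a, b]


lemma gaux_nsq (w : ℝ) (hw : |w| ≤ 2) (n : ℤ) : (n:ℝ)^2 ≤ (2*(n:ℝ)+w)^2/2 + 2 := by
  have h := abs_le.1 hw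
  nlinarith [sq_nonneg (2*(n:ℝ)+2*w), mul_nonneg (sub_nonneg.2 h.1) (sub_nonneg.2 h.2)]

lemma gaux_nat (d : ℝ) (hd : 1 ≤ d) :
    Summable (fun n : ℕ => 2/(d+(n:ℝ))^2) ∧ ∑' n : ℕ, 2/(d+(n:ℝ))^2 ≤ 4/d := by
  have key : ∀ N : ℕ, ∑ n ∈ Finset.range N, 2/(d+(n:ℝ))^2 ≤ 2/(d-1/2) - 2/(d+(N:ℝ)-1/2) := by
    intro N
    induction N with
    | zero => simp
    | succ k ih =>
      rw [Finset.sum_range_succ]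
      have hk : (0:ℝ) ≤ k := Nat.cast_nonneg k
      have : 2/(d+(k:ℝ))^2 ≤ 2/(d+(k:ℝ)-1/2) - 2/(d+((k+1:ℕ):ℝ)-1/2) := by
        push_cast
        have h1 : 0 < d+(k:ℝ)-1/2 := by linarith
        have h2 : 0 < d+((k:ℝ)+1)-1/2 := by linarith
        rw [div_sub_div _ _ h1.ne' h2.ne', div_le_div_iff₀ (by positivity) (by positivity)]
        nlinarith
      linarith
  have key2 : ∀ N : ℕ, ∑ n ∈ Finset.range N, 2/(d+(n:ℝ))^2 ≤ 4/d := by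
    intro N
    refine (key N).trans ?_
    have hk : (0:ℝ) ≤ N := Nat.cast_nonneg N
    have h1 : 0 ≤ 2/(d+(N:ℝ)-1/2) := div_nonneg (by norm_num) (by linarith)
    have h2 : 2/(d-1/2) ≤ 4/d := by
      rw [div_le_div_iff₀ (by linarith) (by linarith)]; linarith
    linarith
  have hnn : ∀ n : ℕ, 0 ≤ 2/(d+(n:ℝ))^2 := fun n => by positivity
  exact ⟨summable_of_sum_range_le hnn key2, Real.tsum_le_of_sum_range_le hnn key2⟩

lemma gaux_int (d : ℝ) (hd : 1 ≤ d) :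
    Summable (fun n : ℤ => 1/(d^2+(n:ℝ)^2)) ∧ ∑' n : ℤ, 1/(d^2+(n:ℝ)^2) ≤ 8/d := by
  obtain ⟨hs, ht⟩ := gaux_nat d hd
  have b1 : ∀ n : ℕ, 1/(d^2+(((n:ℤ)):ℝ)^2) ≤ 2/(d+(n:ℝ))^2 := by
    intro n
    push_cast
    rw [div_le_div_iff₀ (by positivity) (by positivity)]
    nlinarith [sq_nonneg (d-(n:ℝ))]
  have b2 : ∀ n : ℕ, 1/(d^2+(((-(n+1:ℤ)) : ℤ):ℝ)^2) ≤ 2/(d+(n:ℝ))^2 := by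
    intro n
    push_cast
    rw [div_le_div_iff₀ (by positivity) (by positivity)]
    have hk : (0:ℝ) ≤ n := Nat.cast_nonneg n
    nlinarith [sq_nonneg (d-(n:ℝ))]
  have s1 : Summable (fun n : ℕ => 1/(d^2+(((n:ℤ)):ℝ)^2)) :=
    Summable.of_nonneg_of_le (fun n => by positivity) b1 hs
  have s2 : Summable (fun n : ℕ => 1/(d^2+(((-(n+1:ℤ)) : ℤ):ℝ)^2)) :=
    Summable.of_nonneg_of_le (fun n => by positivity) b2 hs
  have h := HasSum.of_nat_of_neg_add_one (f := fun n : ℤ => 1/(d^2+(n:ℝ)^2)) s1.hasSum s2.hasSum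
  refine ⟨h.summable, ?_⟩
  rw [h.tsum_eq]
  have e1 := s1.tsum_le_tsum b1 hs
  have e2 := s2.tsum_le_tsum b2 hs
  have : 8/d = 4/d+4/d := by ring
  linarith

/-- the kernel -/
noncomputable def gk (D a : ℝ) : ℝ := (√(D + a^2)^3)⁻¹

lemma gaux_deriv_a (D : ℝ) (hD : 0 < D) (m : ℕ) (a : ℝ) :
    HasDerivAt (fun a => (√(D + a^2)^m)⁻¹) (-(m * a * (√(D+a^2)^(m+2))⁻¹)) a := by
  have hp : 0 < D + a^2 := by positivity
  have hS : 0 < √(D+a^2) := Real.sqrt_pos.2 hp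
  have h0 : HasDerivAt (fun a : ℝ => D + a^2) (2*a) a := by
    simpa using (hasDerivAt_pow 2 a).const_add D
  have h1 := ((h0.sqrt hp.ne').pow m).inv (pow_pos hS m).ne'
  refine h1.congr_deriv ?_
  rcases m with _ | m
  · simp
  · simp only [Nat.add_sub_cancel, Pi.pow_apply]
    field_simp
    ring

lemma gaux_deriv_t (a t : ℝ) (ht : 0 < t) :
    HasDerivAt (fun t => 1/√(t + a^2)) (-(1/2) * gk t a) t := by
  have hp : 0 < t + a^2 := by positivity
  have hS : 0 < √(t+a^2) := Real.sqrt_pos.2 hp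
  have h0 : HasDerivAt (fun t : ℝ => t + a^2) 1 t := (hasDerivAt_id t).add_const _
  have h1 := (h0.sqrt hp.ne').inv hS.ne'
  simp only [one_div]
  refine h1.congr_deriv ?_
  unfold gk
  field_simp

lemma gk_nonneg (D a : ℝ) : 0 ≤ gk D a := by unfold gk; positivity

lemma gk_le (d D a : ℝ) (hd : 0 < d) (hD : d^2 ≤ D) : gk D a ≤ 1/(d*(D+a^2)) := by
  have hD0 : 0 < D := lt_of_lt_of_le (pow_pos hd 2) hD
  have hp : 0 < D + a^2 := by positivity
  have h1 : d ≤ √(D+a^2) := Real.le_sqrt_of_sq_le (by nlinarith [sq_nonneg a])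
  have h2 : √(D+a^2)^2 = D + a^2 := Real.sq_sqrt hp.le
  unfold gk
  rw [← one_div]
  apply one_div_le_one_div_of_le (by positivity)
  calc d*(D+a^2) ≤ √(D+a^2) * (D+a^2) := by gcongr
    _ = √(D+a^2)^3 := by rw [← h2]; simp; ring

lemma gk_small_term (d w u : ℝ) (n : ℤ) (hd : 0 < d) (hd1 : d ≤ 1) (hw : |w| ≤ 2) (hu : |u| ≤ 1)
    (huw : u^2 ≤ (2*(n:ℝ)+w)^2) :
    d * gk (d^2) (2*(n:ℝ)+w) ≤ 4/(d^2+u^2) * (1/(1^2+(n:ℝ)^2)) := by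
  have h := gk_le d (d^2) (2*(n:ℝ)+w) hd le_rfl
  have hn := gaux_nsq w hw n
  have hu2 : u^2 ≤ 1 := by rw [← sq_abs]; nlinarith [abs_nonneg u]
  calc d * gk (d^2) (2*(n:ℝ)+w) ≤ d * (1/(d*(d^2+(2*(n:ℝ)+w)^2))) := by gcongr
    _ = 1/(d^2+(2*(n:ℝ)+w)^2) := by field_simp
    _ ≤ 4/((d^2+u^2)*(1^2+(n:ℝ)^2)) := by
      rw [div_le_div_iff₀ (by positivity) (by positivity)]
      have e1 : d^2 ≤ 1 := by nlinarith
      have e2 : (d^2+u^2)*(1^2+(n:ℝ)^2) ≤ (d^2+u^2)*(3+(2*(n:ℝ)+w)^2/2) :=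
        mul_le_mul_of_nonneg_left (by linarith) (by positivity)
      have e3 : (d^2+u^2)*((2*(n:ℝ)+w)^2/2) ≤ 2*((2*(n:ℝ)+w)^2/2) :=
        mul_le_mul_of_nonneg_right (by linarith) (by positivity)
      nlinarith
    _ = _ := by field_simp

/-- summability of the kernel -/
lemma gk_summable_bound (τ t w : ℝ) (hτ : 0 < τ) (ht : τ ≤ t) (hw : |w| ≤ 2) (n : ℤ) :
    1/(t+(2*(n:ℝ)+w)^2) ≤ (3/τ+1/2) * (1/(1^2+(n:ℝ)^2)) := by
  have hn := gaux_nsq w hw n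
  have ht0 : 0 < t := lt_of_lt_of_le hτ ht
  have : (0:ℝ) < t + (2*(n:ℝ)+w)^2 := by positivity
  rw [mul_one_div, div_le_div_iff₀ this (by positivity)]
  have e : 3 ≤ 3/τ * t := by rw [div_mul_eq_mul_div, le_div_iff₀ hτ]; linarith
  have e2 : 0 ≤ 3/τ * (2*(n:ℝ)+w)^2 := by positivity
  have : 0 ≤ t := by linarith
  nlinarith

lemma gk_bound (τ t w : ℝ) (hτ : 0 < τ) (ht : τ ≤ t) (hw : |w| ≤ 2) (n : ℤ) :
    gk t (2*(n:ℝ)+w) ≤ (√τ)⁻¹ * (3/τ+1/2) * (1/(1^2+(n:ℝ)^2)) := by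
  have h0 : 0 < √τ := Real.sqrt_pos.2 hτ
  have h := gk_le (√τ) t (2*(n:ℝ)+w) h0 (by rw [Real.sq_sqrt hτ.le]; exact ht)
  have h2 := gk_summable_bound τ t w hτ ht hw n
  calc _ ≤ _ := h
    _ = (√τ)⁻¹ * (1/(t+(2*(n:ℝ)+w)^2)) := by rw [one_div, mul_inv, one_div]
    _ ≤ (√τ)⁻¹ * ((3/τ+1/2) * (1/(1^2+(n:ℝ)^2))) := by gcongr
    _ = _ := by ring

lemma gk_summable (t w : ℝ) (ht : 0 < t) (hw : |w| ≤ 2) :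
    Summable (fun n : ℤ => gk t (2*(n:ℝ)+w)) :=
  Summable.of_nonneg_of_le (fun _ => gk_nonneg _ _) (gk_bound t t w ht le_rfl hw)
    ((gaux_int 1 le_rfl).1.mul_left _)

lemma gk_small (d u v w : ℝ) (hd : 0 < d) (hd1 : d ≤ 1) (hu : |u| ≤ 2) (hv : |v| ≤ 2)
    (hw : |w| ≤ 1) (h1 : ∀ n : ℤ, w^2 ≤ (2*(n:ℝ)+u)^2) (h2 : ∀ n : ℤ, w^2 ≤ (2*(n:ℝ)+v)^2) :
    d * |∑' n : ℤ, (gk (d^2) (2*(n:ℝ)+u) - gk (d^2) (2*(n:ℝ)+v))| ≤ 64/(d^2+w^2) := by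
  obtain ⟨hs, ht⟩ := gaux_int 1 le_rfl
  have hb : ∀ n : ℤ, ‖d * (gk (d^2) (2*(n:ℝ)+u) - gk (d^2) (2*(n:ℝ)+v))‖
      ≤ 8/(d^2+w^2) * (1/(1^2+(n:ℝ)^2)) := by
    intro n
    have e1 := gk_small_term d u w n hd hd1 hu hw (h1 n)
    have e2 := gk_small_term d v w n hd hd1 hv hw (h2 n)
    have p1 := mul_nonneg hd.le (gk_nonneg (d^2) (2*(n:ℝ)+u))
    have p2 := mul_nonneg hd.le (gk_nonneg (d^2) (2*(n:ℝ)+v))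
    have e3 : 8/(d^2+w^2) * (1/(1^2+(n:ℝ)^2)) = 2*(4/(d^2+w^2) * (1/(1^2+(n:ℝ)^2))) := by ring
    rw [Real.norm_eq_abs, abs_le, e3, mul_sub]
    constructor <;> linarith
  have h := tsum_of_norm_bounded ((hs.mul_left (8/(d^2+w^2))).hasSum) hb
  rw [tsum_mul_left, tsum_mul_left, Real.norm_eq_abs, abs_mul, abs_of_pos hd] at h
  refine h.trans ?_
  calc 8/(d^2+w^2) * _ ≤ 8/(d^2+w^2) * (8/1) := by gcongr
    _ = _ := by ring

lemma gk_second (d : ℝ) (hd : 1 ≤ d) (n : ℤ) (u v : ℝ) (hu : |u| ≤ 2) (hv : |v| ≤ 2) :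
    |gk (d^2) (2*(n:ℝ)+u) - gk (d^2) (2*(n:ℝ)+v)
      - (u-v)/2 * (gk (d^2) (2*((n+1:ℤ):ℝ)+0) - gk (d^2) (2*(n:ℝ)+0))|
      ≤ 864/d^3 * (1/(d^2+(n:ℝ)^2)) := by
  have hd0 : 0 < d := by linarith
  set M : ℝ := 54/d^3 * (1/(d^2+(n:ℝ)^2)) with hM
  have hM0 : 0 ≤ M := by positivity
  set J : Set ℝ := Set.Icc (2*(n:ℝ)-2) (2*(n:ℝ)+2) with hJ
  have hconv : Convex ℝ J := convex_Icc _ _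
  have hD : 0 < d^2 := by positivity
  -- lower bound for the square root
  have hS : ∀ t ∈ J, 18 * (√(d^2+t^2)^5)⁻¹ ≤ M := by
    intro t ht
    have hw : |t - 2*(n:ℝ)| ≤ 2 := by rw [abs_le]; constructor <;> linarith [ht.1, ht.2]
    have hn := gaux_nsq _ hw n
    have e : 2*(n:ℝ) + (t-2*(n:ℝ)) = t := by ring
    rw [e] at hn
    have hp : 0 < d^2+t^2 := by positivity
    have h1 : d ≤ √(d^2+t^2) := Real.le_sqrt_of_sq_le (by nlinarith [sq_nonneg t])
    have h2 : √(d^2+t^2)^2 = d^2 + t^2 := Real.sq_sqrt hp.le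
    have h3 : (d^2+(n:ℝ)^2)/3 ≤ √(d^2+t^2)^2 := by rw [h2]; nlinarith
    have h4 : d^3*((d^2+(n:ℝ)^2)/3) ≤ √(d^2+t^2)^5 := by
      calc _ ≤ √(d^2+t^2)^3 * √(d^2+t^2)^2 := by gcongr
        _ = _ := by ring
    calc 18 * (√(d^2+t^2)^5)⁻¹ ≤ 18 * (d^3*((d^2+(n:ℝ)^2)/3))⁻¹ := by gcongr
      _ = M := by rw [hM]; field_simp; norm_num
  -- first derivative is Lipschitz
  let f' : ℝ → ℝ := fun a => -(3 * a * (√(d^2+a^2)^5)⁻¹)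
  have hf : ∀ t, HasDerivAt (gk (d^2)) (f' t) t := by
    intro t
    have := gaux_deriv_a (d^2) hD 3 t
    exact_mod_cast this
  have hf' : ∀ t, HasDerivAt f' (-(3 * (√(d^2+t^2)^5)⁻¹ + 3*t*(-(5 * t * (√(d^2+t^2)^7)⁻¹)))) t := by
    intro t
    have h5 := gaux_deriv_a (d^2) hD 5 t
    have h3 : HasDerivAt (fun a : ℝ => 3*a) 3 t := by simpa using (hasDerivAt_id t).const_mul 3
    have := (h3.mul h5).neg
    exact_mod_cast this
  have hf'b : ∀ t ∈ J, ‖-(3 * (√(d^2+t^2)^5)⁻¹ + 3*t*(-(5 * t * (√(d^2+t^2)^7)⁻¹)))‖ ≤ M := by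
    intro t ht
    refine le_trans ?_ (hS t ht)
    have hp : 0 < d^2+t^2 := by positivity
    have hs : 0 < √(d^2+t^2) := Real.sqrt_pos.2 hp
    have h2 : √(d^2+t^2)^2 = d^2 + t^2 := Real.sq_sqrt hp.le
    have h7 : t^2 * (√(d^2+t^2)^7)⁻¹ ≤ (√(d^2+t^2)^5)⁻¹ := by
      have : t^2 ≤ √(d^2+t^2)^2 := by rw [h2]; nlinarith
      calc t^2 * (√(d^2+t^2)^7)⁻¹ ≤ √(d^2+t^2)^2 * (√(d^2+t^2)^7)⁻¹ := by gcongr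
        _ = _ := by field_simp
    have h7' : 0 ≤ t^2 * (√(d^2+t^2)^7)⁻¹ := by positivity
    have h5' : 0 ≤ (√(d^2+t^2)^5)⁻¹ := by positivity
    rw [Real.norm_eq_abs, abs_le]
    constructor <;> nlinarith
  have hcJ : 2*(n:ℝ) ∈ J := by constructor <;> linarith
  have hg : ∀ t ∈ J, HasDerivWithinAt (fun t => gk (d^2) t - f' (2*(n:ℝ)) * t)
      (f' t - f' (2*(n:ℝ))) J t := by
    intro t _
    have h3 : HasDerivAt (fun a : ℝ => f' (2*(n:ℝ)) * a) (f' (2*(n:ℝ))) t := by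
      simpa using (hasDerivAt_id t).const_mul (f' (2*(n:ℝ)))
    exact ((hf t).sub h3).hasDerivWithinAt
  have hgb : ∀ t ∈ J, ‖f' t - f' (2*(n:ℝ))‖ ≤ 2*M := by
    intro t ht
    have := hconv.norm_image_sub_le_of_norm_hasDerivWithin_le
      (fun x _ => (hf' x).hasDerivWithinAt) hf'b hcJ ht
    refine this.trans ?_
    have hw : ‖t - 2*(n:ℝ)‖ ≤ 2 := by
      rw [Real.norm_eq_abs, abs_le]; constructor <;> linarith [ht.1, ht.2]
    nlinarith
  have hlip : ∀ x ∈ J, ∀ y ∈ J, |(gk (d^2) y - f' (2*(n:ℝ)) * y) - (gk (d^2) x - f' (2*(n:ℝ)) * x)|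
      ≤ 2*M*|y-x| := by
    intro x hx y hy
    exact hconv.norm_image_sub_le_of_norm_hasDerivWithin_le hg hgb hx hy
  have hu' := abs_le.1 hu
  have hv' := abs_le.1 hv
  have m1 := hlip (2*(n:ℝ)+v) ⟨by linarith, by linarith⟩ (2*(n:ℝ)+u) ⟨by linarith, by linarith⟩
  have m2 := hlip (2*(n:ℝ)) hcJ (2*(n:ℝ)+2) ⟨by linarith, by linarith⟩
  have e1 : |2*(n:ℝ)+u - (2*(n:ℝ)+v)| ≤ 4 := by rw [abs_le]; constructor <;> linarith
  have e2 : |2*(n:ℝ)+2 - 2*(n:ℝ)| = 2 := by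
    rw [show 2*(n:ℝ)+2 - 2*(n:ℝ) = 2 by ring]; norm_num
  rw [e2] at m2
  have m1' := m1.trans (mul_le_mul_of_nonneg_left e1 (by positivity : 0 ≤ 2*M))
  have e3 : |(u-v)/2| ≤ 2 := by rw [abs_le]; constructor <;> linarith
  have m3 := mul_le_mul e3 m2 (abs_nonneg _) (by norm_num)
  rw [← abs_mul] at m3
  have c1 : 2*((n+1:ℤ):ℝ)+0 = 2*(n:ℝ)+2 := by push_cast; ring
  have c2 : 2*(n:ℝ)+0 = 2*(n:ℝ) := by ring
  rw [c1, c2]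
  have hfin : 864/d^3 * (1/(d^2+(n:ℝ)^2)) = 16*M := by rw [hM]; ring
  rw [hfin]
  rw [abs_le] at m1' m3 ⊢
  constructor <;> linarith [m1'.1, m1'.2, m3.1, m3.2]

lemma gk_large (d u v : ℝ) (hd : 1 ≤ d) (hu : |u| ≤ 2) (hv : |v| ≤ 2) :
    d * |∑' n : ℤ, (gk (d^2) (2*(n:ℝ)+u) - gk (d^2) (2*(n:ℝ)+v))| ≤ 6912/d^3 := by
  have hd0 : 0 < d := by linarith
  have hD : 0 < d^2 := by positivity
  obtain ⟨hs, ht⟩ := gaux_int d hd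
  have su := gk_summable (d^2) u hD hu
  have sv := gk_summable (d^2) v hD hv
  have s0 := gk_summable (d^2) 0 hD (by norm_num)
  have s1 : Summable (fun n : ℤ => gk (d^2) (2*((n+1:ℤ):ℝ)+0)) :=
    (Equiv.addRight (1:ℤ)).summable_iff.2 s0
  have e1 : ∑' n : ℤ, gk (d^2) (2*((n+1:ℤ):ℝ)+0) = ∑' n : ℤ, gk (d^2) (2*(n:ℝ)+0) :=
    (Equiv.addRight (1:ℤ)).tsum_eq (fun n : ℤ => gk (d^2) (2*(n:ℝ)+0))
  have h := tsum_of_norm_bounded (f := fun n : ℤ => gk (d^2) (2*(n:ℝ)+u) - gk (d^2) (2*(n:ℝ)+v)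
      - (u-v)/2 * (gk (d^2) (2*((n+1:ℤ):ℝ)+0) - gk (d^2) (2*(n:ℝ)+0)))
    ((hs.mul_left (864/d^3)).hasSum) (fun n => gk_second d hd n u v hu hv)
  rw [(su.sub sv).tsum_sub ((s1.sub s0).mul_left _), tsum_mul_left, s1.tsum_sub s0, e1, sub_self,
    mul_zero, sub_zero, tsum_mul_left, Real.norm_eq_abs] at h
  calc _ ≤ d * (864/d^3 * (8/d)) := by
        gcongr
        refine h.trans ?_
        gcongr
    _ = _ := by field_simp; norm_num

lemma gk_all (d u v w : ℝ) (hd : 0 < d) (hu : |u| ≤ 2) (hv : |v| ≤ 2)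
    (hw : |w| ≤ 1) (h1 : ∀ n : ℤ, w^2 ≤ (2*(n:ℝ)+u)^2) (h2 : ∀ n : ℤ, w^2 ≤ (2*(n:ℝ)+v)^2) :
    d * |∑' n : ℤ, (gk (d^2) (2*(n:ℝ)+u) - gk (d^2) (2*(n:ℝ)+v))| ≤ 13824/(d^2+w^2) := by
  have hp : 0 < d^2+w^2 := by positivity
  rcases le_total d 1 with h | h
  · refine (gk_small d u v w hd h hu hv hw h1 h2).trans ?_
    gcongr; norm_num
  · refine (gk_large d u v h hu hv).trans ?_
    rw [div_le_div_iff₀ (by positivity) hp]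
    have hw2 : w^2 ≤ 1 := by rw [← sq_abs]; nlinarith [abs_nonneg w]
    have : d^2 ≤ d^3 := pow_le_pow_right₀ h (by norm_num)
    nlinarith

/-- termwise differentiation -/
lemma gH_deriv (u v t : ℝ) (ht : 0 < t) (hu : |u| ≤ 2) (hv : |v| ≤ 2) :
    HasDerivAt (fun t => ∑' n : ℤ, (1/√(t+(2*(n:ℝ)+u)^2) - 1/√(t+(2*(n:ℝ)+v)^2)))
      (∑' n : ℤ, (-(1/2) * gk t (2*(n:ℝ)+u) - -(1/2) * gk t (2*(n:ℝ)+v))) t := by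
  obtain ⟨hs, -⟩ := gaux_int 1 le_rfl
  have hτ : 0 < t/2 := by positivity
  refine hasDerivAt_tsum_of_isPreconnected (t := Set.Ioi (t/2))
    (hs.mul_left ((√(t/2))⁻¹ * (3/(t/2)+1/2))) isOpen_Ioi isPreconnected_Ioi
    (g := fun (n : ℤ) t => (1/√(t+(2*(n:ℝ)+u)^2) - 1/√(t+(2*(n:ℝ)+v)^2)))
    (g' := fun (n : ℤ) t => (-(1/2) * gk t (2*(n:ℝ)+u) - -(1/2) * gk t (2*(n:ℝ)+v)))
    ?_ ?_ (y₀ := t) (by simp; exact ht) ?_ (by simp; exact ht)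
  · intro n s hs
    have hs0 : 0 < s := hτ.trans hs
    exact (gaux_deriv_t _ s hs0).sub (gaux_deriv_t _ s hs0)
  · intro n s hs
    have b1 := gk_bound (t/2) s u hτ (le_of_lt hs) hu n
    have b2 := gk_bound (t/2) s v hτ (le_of_lt hs) hv n
    have p1 := gk_nonneg s (2*(n:ℝ)+u)
    have p2 := gk_nonneg s (2*(n:ℝ)+v)
    rw [Real.norm_eq_abs, abs_le]
    constructor <;> linarith
  · refine Summable.of_norm_bounded (hs.mul_left (4*(3/t+1/2))) ?_
    intro n
    set a := 2*(n:ℝ)+u with ha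
    set b := 2*(n:ℝ)+v with hb
    have b1 := gk_summable_bound t t u ht le_rfl hu n
    have b2 := gk_summable_bound t t v ht le_rfl hv n
    rw [← ha] at b1
    rw [← hb] at b2
    have pa : 0 < t+a^2 := by positivity
    have pb : 0 < t+b^2 := by positivity
    have sa := Real.sqrt_pos.2 pa
    have sb := Real.sqrt_pos.2 pb
    have qa := Real.sq_sqrt pa.le
    have qb := Real.sq_sqrt pb.le
    have la : |a| ≤ √(t+a^2) := Real.abs_le_sqrt (by linarith)
    have lb : |b| ≤ √(t+b^2) := Real.abs_le_sqrt (by linarith)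
    rw [← qa] at b1
    rw [← qb] at b2
    generalize √(t+a^2) = A at *
    generalize √(t+b^2) = B at *
    have hAB : |B - A| ≤ 4 := by
      have h1 : |B-A| * (A+B) = |b-a| * |a+b| := by
        have h0 : |B-A| * |A+B| = |b-a| * |a+b| := by
          rw [← abs_mul, ← abs_mul]
          congr 1; linear_combination qb - qa
        rwa [abs_of_pos (add_pos sa sb)] at h0
      have h2 : |b-a| ≤ 4 := by
        have hu' := abs_le.1 hu
        have hv' := abs_le.1 hv
        rw [abs_le]; constructor <;> linarith
      have h3 : |a+b| ≤ A+B := (abs_add_le a b).trans (add_le_add la lb)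
      have h4 : |b-a| * |a+b| ≤ 4*(A+B) := mul_le_mul h2 h3 (abs_nonneg _) (by norm_num)
      rw [← h1] at h4
      exact le_of_mul_le_mul_right h4 (by positivity)
    have e : 1/A - 1/B = (B-A) * (1/A*(1/B)) := by field_simp
    rw [e, Real.norm_eq_abs, abs_mul, abs_of_pos (by positivity : 0 < 1/A*(1/B))]
    have hq : 1/A*(1/B) ≤ (3/t+1/2) * (1/(1^2+(n:ℝ)^2)) := by
      have x1 : 1/A^2 = (1/A)^2 := by ring
      have x2 : 1/B^2 = (1/B)^2 := by ring
      nlinarith [sq_nonneg (1/A-1/B)]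
    calc _ ≤ 4 * ((3/t+1/2) * (1/(1^2+(n:ℝ)^2))) := by gcongr
      _ = _ := by ring

lemma vec2_norm (a b c e : ℝ) : ‖vec2 a b - vec2 c e‖^2 = (a-c)^2 + (b-e)^2 := by
  rw [EuclideanSpace.norm_sq_eq]
  simp [vec2, Fin.sum_univ_two]

lemma green_pt (q s0 c z l d : ℝ) (N : ℝ → ℝ) (hN : ∀ s, N s ^ 2 = s^2+q^2-2*s*q*c)
    (hc : c^2 ≤ 1) (hz : z ∈ Set.Icc (0:ℝ) 1) (hl : l ∈ Set.Icc (0:ℝ) 1)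
    (hd : 0 < d) (hdd : d^2 = s0^2+q^2-2*s0*q*c) :
    |deriv (fun s => (1/(4*π)) * ∑' n : ℤ, greenTerm (N s) z l n) s0| ≤
      d * |∑' n : ℤ, (gk (d^2) (2*(n:ℝ)+(z-l)) - gk (d^2) (2*(n:ℝ)+(-(z+l))))| := by
  have hu : |z-l| ≤ 2 := by
    rw [abs_le]; constructor <;> linarith [hz.1, hz.2, hl.1, hl.2]
  have hv : |-(z+l)| ≤ 2 := by
    rw [abs_le]; constructor <;> linarith [hz.1, hz.2, hl.1, hl.2]
  have hD : 0 < d^2 := by positivity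
  have hH := gH_deriv (z-l) (-(z+l)) (d^2) hD hu hv
  have hP : HasDerivAt (fun s : ℝ => s^2+q^2-2*s*q*c) (2*s0-2*q*c) s0 := by
    have h1 : HasDerivAt (fun s : ℝ => s^2+q^2) (2*s0) s0 := by
      simpa using (hasDerivAt_pow 2 s0).add_const (q^2)
    have h2 : HasDerivAt (fun s : ℝ => 2*s*q*c) (2*q*c) s0 := by
      have := (hasDerivAt_id s0).const_mul (2*q*c)
      simp only [mul_one] at this
      refine this.congr_of_eventuallyEq (Filter.Eventually.of_forall fun s => ?_)
      simp; ring
    exact h1.sub h2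
  rw [hdd] at hH
  have hcomp := (HasDerivAt.comp s0 hH hP).const_mul (1/(4*π))
  have hfun : (fun s => (1/(4*π)) * ∑' n : ℤ, greenTerm (N s) z l n) =
      fun s => (1/(4*π)) * ((fun t => ∑' n : ℤ, (1/√(t+(2*(n:ℝ)+(z-l))^2)
        - 1/√(t+(2*(n:ℝ)+(-(z+l)))^2))) ∘ (fun s : ℝ => s^2+q^2-2*s*q*c)) s := by
    funext s
    simp only [Function.comp, greenTerm, hN]
    congr 1
    refine tsum_congr fun n => ?_
    rw [show (z - l + 2*(n:ℝ))^2 = (2*(n:ℝ)+(z-l))^2 by ring,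
      show (z + l - 2*(n:ℝ))^2 = (2*(n:ℝ)+(-(z+l)))^2 by ring]
  rw [hfun, hcomp.deriv, ← hdd]
  have hsum : ∑' n : ℤ, (-(1/2) * gk (d^2) (2*(n:ℝ)+(z-l)) - -(1/2) * gk (d^2) (2*(n:ℝ)+(-(z+l))))
      = -(1/2) * ∑' n : ℤ, (gk (d^2) (2*(n:ℝ)+(z-l)) - gk (d^2) (2*(n:ℝ)+(-(z+l)))) := by
    rw [← tsum_mul_left]
    exact tsum_congr fun n => by ring
  rw [hsum]
  generalize ∑' n : ℤ, (gk (d^2) (2*(n:ℝ)+(z-l)) - gk (d^2) (2*(n:ℝ)+(-(z+l)))) = S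
  have hx : |2*s0-2*q*c| ≤ 2*d := by
    apply abs_le_of_sq_le_sq _ (by positivity)
    nlinarith [mul_nonneg (sq_nonneg q) (sub_nonneg.2 hc)]
  have hpi : 1/(4*π) ≤ 1 := by
    rw [div_le_one (by positivity)]; linarith [Real.pi_gt_three]
  rw [abs_mul, abs_mul, abs_mul, abs_of_pos (by positivity : 0 < 1/(4*π))]
  have : |(-(1/2):ℝ)| = 1/2 := by norm_num
  rw [this]
  calc 1/(4*π) * (1/2*|S| * |2*s0-2*q*c|) ≤ 1 * (1/2*|S| * (2*d)) := by gcongr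
    _ = _ := by ring

lemma green_cond1 (z l : ℝ) (hz : z ∈ Set.Icc (0:ℝ) 1) (hl : l ∈ Set.Icc (0:ℝ) 1) (n : ℤ) :
    (z-l)^2 ≤ (2*(n:ℝ)+(z-l))^2 := by
  obtain ⟨hz0, hz1⟩ := hz
  obtain ⟨hl0, hl1⟩ := hl
  have : n ≤ -1 ∨ n = 0 ∨ 1 ≤ n := by omega
  rcases this with h | h | h
  · have : (n:ℝ) ≤ -1 := by exact_mod_cast h
    nlinarith
  · subst h; simp
  · have : (1:ℝ) ≤ n := by exact_mod_cast h
    nlinarith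

lemma green_cond2 (z l : ℝ) (hz : z ∈ Set.Icc (0:ℝ) 1) (hl : l ∈ Set.Icc (0:ℝ) 1) (n : ℤ) :
    (z-l)^2 ≤ (2*(n:ℝ)+(-(z+l)))^2 := by
  obtain ⟨hz0, hz1⟩ := hz
  obtain ⟨hl0, hl1⟩ := hl
  have : n ≤ 0 ∨ 1 ≤ n := by omega
  rcases this with h | h
  · have : (n:ℝ) ≤ 0 := by exact_mod_cast h
    have e : 0 ≤ (z - n) * (l - n) := mul_nonneg (by linarith) (by linarith)
    nlinarith
  · have : (1:ℝ) ≤ n := by exact_mod_cast h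
    have e : 0 ≤ (n - z) * (n - l) := mul_nonneg (by linarith) (by linarith)
    nlinarith

lemma gint_arctan (e k b : ℝ) (he : 0 < e) (hk : 0 < k) :
    ∫ x in (0:ℝ)..b, 1/(e^2+k^2*x^2) ≤ π/(2*(e*k)) := by
  have hder : ∀ x ∈ Set.uIcc (0:ℝ) b,
      HasDerivAt (fun x => 1/(e*k) * Real.arctan (k/e*x)) (1/(e^2+k^2*x^2)) x := by
    intro x _
    have h1 : HasDerivAt (fun x : ℝ => k/e*x) (k/e) x := by
      simpa using (hasDerivAt_id x).const_mul (k/e)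
    refine (h1.arctan.const_mul (1/(e*k))).congr_deriv ?_
    have : 0 < e^2+k^2*x^2 := by positivity
    have h2 : 1 + (k/e*x)^2 = (e^2+k^2*x^2)/e^2 := by field_simp
    rw [h2]
    field_simp
  have hcont : Continuous (fun x : ℝ => 1/(e^2+k^2*x^2)) := by
    apply Continuous.div continuous_const (by fun_prop)
    intro x; positivity
  rw [intervalIntegral.integral_eq_sub_of_hasDerivAt hder (hcont.intervalIntegrable _ _)]
  simp only [mul_zero, Real.arctan_zero, sub_zero]
  calc 1/(e*k) * Real.arctan (k/e*b) ≤ 1/(e*k) * (π/2) := by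
        gcongr; exact (Real.arctan_lt_pi_div_two _).le
    _ = _ := by field_simp

lemma gint_main (f : ℝ → ℝ) (K e r : ℝ) (hK : 0 ≤ K) (he : 0 < e) (hr : 0 < r)
    (hf0 : ∀ φ, 0 ≤ f φ)
    (hf : ∀ φ, f φ ≤ K/(e^2 + r^2*(3/2)*(1-Real.cos φ))) :
    ∫ φ in (0:ℝ)..(2*π), f φ ≤ 8*K/(r*e) := by
  have hpi := Real.pi_pos
  have hk : 0 < r/2 := by positivity
  have hcont : Continuous (fun x : ℝ => 1/(e^2+(r/2)^2*x^2)) := by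
    apply Continuous.div continuous_const (by fun_prop)
    intro x; positivity
  have hcont2 : Continuous (fun x : ℝ => 1/(e^2+(r/2)^2*(2*π-x)^2)) := by
    apply Continuous.div continuous_const (by fun_prop)
    intro x; positivity
  have hcos : ∀ x, 0 ≤ x → x ≤ π → (r/2)^2*x^2 ≤ r^2*(3/2)*(1-Real.cos x) := by
    intro x hx0 hxp
    have h1 : Real.cos x = 1 - 2*Real.sin (x/2)^2 := by
      have := Real.cos_two_mul' (x/2)
      rw [show 2*(x/2) = x by ring] at this
      rw [this, Real.cos_sq']; ring
    have h2 : x/π ≤ Real.sin (x/2) := by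
      have := Real.mul_le_sin (x := x/2) (by linarith) (by linarith)
      calc x/π = 2/π*(x/2) := by ring
        _ ≤ _ := this
    have h3 : (x/π)^2 ≤ Real.sin (x/2)^2 := pow_le_pow_left₀ (by positivity) h2 2
    have h4 : x^2/12 ≤ (x/π)^2 := by
      rw [div_pow]
      gcongr
      nlinarith [Real.pi_lt_d2]
    rw [h1]
    nlinarith [mul_le_mul_of_nonneg_left (h4.trans h3) (sq_nonneg r)]
  have hbd : ∀ x ∈ Set.Icc (0:ℝ) (2*π),
      f x ≤ K*(1/(e^2+(r/2)^2*x^2)) + K*(1/(e^2+(r/2)^2*(2*π-x)^2)) := by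
    intro x hx
    refine (hf x).trans ?_
    have p1 : 0 ≤ K*(1/(e^2+(r/2)^2*x^2)) := by positivity
    have p2 : 0 ≤ K*(1/(e^2+(r/2)^2*(2*π-x)^2)) := by positivity
    rcases le_total x π with h | h
    · have := hcos x hx.1 h
      have : K/(e^2 + r^2*(3/2)*(1-Real.cos x)) ≤ K*(1/(e^2+(r/2)^2*x^2)) := by
        rw [mul_one_div]; gcongr
      linarith
    · have := hcos (2*π-x) (by linarith [hx.2]) (by linarith)
      rw [Real.cos_two_pi_sub] at this
      have : K/(e^2 + r^2*(3/2)*(1-Real.cos x)) ≤ K*(1/(e^2+(r/2)^2*(2*π-x)^2)) := by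
        rw [mul_one_div]; gcongr
      linarith
  have i1 : IntervalIntegrable (fun x => K*(1/(e^2+(r/2)^2*x^2))) MeasureTheory.volume 0 (2*π) :=
    (continuous_const.mul hcont).intervalIntegrable _ _
  have i2 : IntervalIntegrable (fun x => K*(1/(e^2+(r/2)^2*(2*π-x)^2)))
      MeasureTheory.volume 0 (2*π) := (continuous_const.mul hcont2).intervalIntegrable _ _
  have hle : ∫ φ in (0:ℝ)..(2*π), f φ ≤ ∫ x in (0:ℝ)..(2*π),
      (K*(1/(e^2+(r/2)^2*x^2)) + K*(1/(e^2+(r/2)^2*(2*π-x)^2))) := by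
    rw [intervalIntegral.integral_of_le (by positivity),
      intervalIntegral.integral_of_le (by positivity)]
    apply MeasureTheory.integral_mono_of_nonneg (Filter.Eventually.of_forall hf0)
      ((intervalIntegrable_iff_integrableOn_Ioc_of_le (by positivity)).1 (i1.add i2))
    filter_upwards [MeasureTheory.ae_restrict_mem measurableSet_Ioc] with x hx
    exact hbd x ⟨hx.1.le, hx.2⟩
  refine hle.trans ?_
  rw [intervalIntegral.integral_add i1 i2, intervalIntegral.integral_const_mul,
    intervalIntegral.integral_const_mul,
    intervalIntegral.integral_comp_sub_left (fun x => 1/(e^2+(r/2)^2*x^2))]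
  simp only [sub_self, sub_zero]
  have h := gint_arctan e (r/2) (2*π) he hk
  calc _ ≤ K*(π/(2*(e*(r/2)))) + K*(π/(2*(e*(r/2)))) := by gcongr
    _ = 2*π*K/(r*e) := by field_simp; norm_num
    _ ≤ 8*K/(r*e) := by gcongr; linarith [Real.pi_lt_four]

/-- Angular integral bounds for the radial derivatives of the Green
function: with `x = (r,0,z)` and `y(φ) = (ρ cos φ, ρ sin φ, l)`, the integral over
`φ ∈ [0,2π]` of `|∂_ρ G| + |∂_r G|` is bounded by `C/(r|ρ−r|²)` when `1 ≤ |ρ−r| ≤ r/4`,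
and by `C/(r(|ρ−r| + |z−l|))` when `0 < |ρ−r| < 1`. -/
theorem green_angular_integral_derivative_bound :
    ∃ C : ℝ, 0 < C ∧
      ∀ r ρ z l : ℝ, 0 < r → 0 < ρ → z ∈ Set.Icc (0:ℝ) 1 → l ∈ Set.Icc (0:ℝ) 1 →
        0 < |ρ - r| → |ρ - r| ≤ r / 4 →
        ((1 ≤ |ρ - r| →
          (∫ φ in (0:ℝ)..(2 * π),
              (|deriv (fun s => greenG (vec2 r 0) z
                  (vec2 (s * Real.cos φ) (s * Real.sin φ)) l) ρ|
                + |deriv (fun s => greenG (vec2 s 0) z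
                  (vec2 (ρ * Real.cos φ) (ρ * Real.sin φ)) l) r|))
            ≤ C / (r * |ρ - r| ^ 2)) ∧
        (|ρ - r| < 1 →
          (∫ φ in (0:ℝ)..(2 * π),
              (|deriv (fun s => greenG (vec2 r 0) z
                  (vec2 (s * Real.cos φ) (s * Real.sin φ)) l) ρ|
                + |deriv (fun s => greenG (vec2 s 0) z
                  (vec2 (ρ * Real.cos φ) (ρ * Real.sin φ)) l) r|))
            ≤ C / (r * (|ρ - r| + |z - l|)))) := by
  refine ⟨1000000, by norm_num, ?_⟩
  intro r ρ z l hr hρ hz hl hδ hδr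
  set δ := |ρ - r| with hδdef
  have hδ2 : δ^2 = (ρ-r)^2 := sq_abs _
  have hρr : 3/4*r ≤ ρ := by
    have := (abs_le.1 hδr).1
    linarith
  -- lower bound for the squared distance
  have hDlow : ∀ φ, δ^2 + r^2*(3/2)*(1-Real.cos φ) ≤ ρ^2+r^2-2*ρ*r*Real.cos φ := by
    intro φ
    have h1 : 0 ≤ 1 - Real.cos φ := by linarith [Real.cos_le_one φ]
    have h2 : 0 ≤ r*(ρ - 3/4*r)*(1-Real.cos φ) :=
      mul_nonneg (mul_nonneg hr.le (by linarith)) h1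
    nlinarith
  have hlow0 : ∀ φ, 0 ≤ r^2*(3/2)*(1-Real.cos φ) := fun φ =>
    mul_nonneg (by positivity) (by linarith [Real.cos_le_one φ])
  have hDpos : ∀ φ, 0 < ρ^2+r^2-2*ρ*r*Real.cos φ := by
    intro φ
    have := hDlow φ
    have := hlow0 φ
    have : 0 < δ^2 := by positivity
    linarith
  set d : ℝ → ℝ := fun φ => √(ρ^2+r^2-2*ρ*r*Real.cos φ) with hddef
  have hd : ∀ φ, 0 < d φ := fun φ => Real.sqrt_pos.2 (hDpos φ)
  have hdsq : ∀ φ, d φ^2 = ρ^2+r^2-2*ρ*r*Real.cos φ := fun φ => Real.sq_sqrt (hDpos φ).le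
  set T : ℝ → ℝ := fun φ => d φ *
    |∑' n : ℤ, (gk (d φ^2) (2*(n:ℝ)+(z-l)) - gk (d φ^2) (2*(n:ℝ)+(-(z+l))))| with hT
  have hu : |z-l| ≤ 1 := by
    rw [abs_le]; constructor <;> linarith [hz.1, hz.2, hl.1, hl.2]
  have hu2 : |z-l| ≤ 2 := by linarith
  have hv : |-(z+l)| ≤ 2 := by
    rw [abs_le]; constructor <;> linarith [hz.1, hz.2, hl.1, hl.2]
  have hpt : ∀ φ, |deriv (fun s => greenG (vec2 r 0) z
                  (vec2 (s * Real.cos φ) (s * Real.sin φ)) l) ρ|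
                + |deriv (fun s => greenG (vec2 s 0) z
                  (vec2 (ρ * Real.cos φ) (ρ * Real.sin φ)) l) r| ≤ 2 * T φ := by
    intro φ
    have hcs := Real.sin_sq_add_cos_sq φ
    have hc : Real.cos φ^2 ≤ 1 := by nlinarith [sq_nonneg (Real.sin φ)]
    have a1 := green_pt r ρ (Real.cos φ) z l (d φ)
      (fun s => ‖vec2 r 0 - vec2 (s * Real.cos φ) (s * Real.sin φ)‖)
      (fun s => by rw [vec2_norm]; linear_combination s^2 * hcs) hc hz hl (hd φ) (hdsq φ)
    have a2 := green_pt ρ r (Real.cos φ) z l (d φ)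
      (fun s => ‖vec2 s 0 - vec2 (ρ * Real.cos φ) (ρ * Real.sin φ)‖)
      (fun s => by rw [vec2_norm]; linear_combination ρ^2 * hcs) hc hz hl (hd φ)
      (by rw [hdsq]; ring)
    unfold greenG
    linarith
  have hnn : ∀ φ, 0 ≤ |deriv (fun s => greenG (vec2 r 0) z
                  (vec2 (s * Real.cos φ) (s * Real.sin φ)) l) ρ|
                + |deriv (fun s => greenG (vec2 s 0) z
                  (vec2 (ρ * Real.cos φ) (ρ * Real.sin φ)) l) r| := fun φ => by positivity
  constructor
  · intro h1
    refine (gint_main _ (13824/δ) δ r (by positivity) hδ hr hnn ?_).trans ?_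
    · intro φ
      refine (hpt φ).trans ?_
      have hdδ : δ ≤ d φ := Real.le_sqrt_of_sq_le (by linarith [hDlow φ, hlow0 φ])
      have := gk_large (d φ) (z-l) (-(z+l)) (h1.trans hdδ) hu2 hv
      have hl0 := hlow0 φ
      have hlow := hDlow φ
      rw [← hdsq] at hlow
      have hdp := hd φ
      calc 2 * T φ ≤ 2 * (6912/(d φ)^3) := by gcongr
        _ = 13824/(d φ * d φ^2) := by ring
        _ ≤ 13824/(δ * (δ^2 + r^2*(3/2)*(1-Real.cos φ))) := by gcongr
        _ = _ := by rw [div_div]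
    · rw [show 8*(13824/δ)/(r*δ) = 110592/(r*δ^2) by field_simp; norm_num]
      gcongr; norm_num
  · intro _
    set e := (δ + |z-l|)/2 with hedef
    have he : 0 < e := by positivity
    refine (gint_main _ 27648 e r (by positivity) he hr hnn ?_).trans ?_
    · intro φ
      refine (hpt φ).trans ?_
      have := gk_all (d φ) (z-l) (-(z+l)) (z-l) (hd φ) hu2 hv hu
        (green_cond1 z l hz hl) (green_cond2 z l hz hl)
      have hl0 := hlow0 φ
      have hlow := hDlow φ
      rw [← hdsq] at hlow
      have hee : e^2 ≤ δ^2 + (z-l)^2 := by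
        rw [hedef, ← sq_abs (z-l)]
        nlinarith [sq_nonneg (δ - |z-l|), sq_nonneg δ, sq_nonneg (|z-l|)]
      calc 2 * T φ ≤ 2 * (13824/(d φ^2+(z-l)^2)) := by gcongr
        _ = 27648/(d φ^2+(z-l)^2) := by ring
        _ ≤ _ := by
          gcongr 27648 / ?_
          linarith
    · rw [show 8*27648/(r*e) = 442368/(r*(δ+|z-l|)) by rw [hedef]; field_simp; norm_num]
      gcongr; norm_num
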